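/- arXiv:0907.5486 — 3 statements merged into one kernel-verified Lean document; each statement's English description precedes it below -/
import Mathlib

section
/- The Pohozaev-type identity 2·∫_ℝ Q'(x)² dx = ((p−1)/(p+1))·∫_ℝ Q(x)^(p+1) dx holds. -/
/-- The soliton profile `Q(x) = ((p+1)/(2 cosh²(((p−1)/2)x)))^(1/(p−1))`. -/
noncomputable def Q (p : ℕ) (x : ℝ) : ℝ :=
  (((p : ℝ) + 1) / (2 * Real.cosh ((((p : ℝ) - 1) / 2) * x) ^ 2)) ^ (1 / ((p : ℝ) - 1))

open Real MeasureTheory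

lemma Q_pos (p : ℕ) (x : ℝ) : 0 < Q p x := by
  unfold Q
  have := cosh_pos ((((p : ℝ) - 1) / 2) * x)
  positivity

/-- The pointwise form of `Q ^ (p - 1) = (p + 1) / 2 * sech²`, multiplied by `Q ^ 2`. -/
lemma Q_pow_succ {p : ℕ} (hp : 2 ≤ p) (x : ℝ) :
    Q p x ^ (p + 1) =
      Q p x ^ 2 * (((p : ℝ) + 1) / (2 * cosh ((((p : ℝ) - 1) / 2) * x) ^ 2)) := by
  have hc := cosh_pos ((((p : ℝ) - 1) / 2) * x)
  have hn : p - 1 ≠ 0 := by omega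
  rw [show p + 1 = 2 + (p - 1) by omega, pow_add]
  congr 1
  have hcast : ((p - 1 : ℕ) : ℝ) = (p : ℝ) - 1 := by
    rw [Nat.cast_sub (by omega), Nat.cast_one]
  unfold Q
  rw [← hcast, one_div, rpow_inv_natCast_pow (by positivity) hn]

lemma hasDerivAt_Q {p : ℕ} (hp : 2 ≤ p) (x : ℝ) :
    HasDerivAt (Q p) (-(tanh ((((p : ℝ) - 1) / 2) * x) * Q p x)) x := by
  have hp' : (2 : ℝ) ≤ p := by exact_mod_cast hp
  have hp1 : (p : ℝ) - 1 ≠ 0 := by linarith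
  set k : ℝ := ((p : ℝ) - 1) / 2 with hk
  have hc := cosh_pos (k * x)
  have hlin : HasDerivAt (fun y => k * y) k x := by
    simpa using (hasDerivAt_id x).const_mul k
  have hden := ((hlin.cosh.pow 2).const_mul 2)
  have hbase := (hasDerivAt_const x ((p : ℝ) + 1)).div hden (by simp; positivity)
  have h := hbase.rpow_const (p := 1 / ((p : ℝ) - 1)) (Or.inl (by
    simp only [Pi.div_apply, Pi.pow_apply]
    positivity))
  refine h.congr_deriv ?_
  have hb : 0 < ((p : ℝ) + 1) / (2 * cosh (k * x) ^ 2) := by positivity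
  simp only [Pi.div_apply, Pi.pow_apply]
  rw [rpow_sub_one hb.ne', tanh_eq_sinh_div_cosh]
  unfold Q
  rw [← hk]
  field_simp
  rw [hk]
  field_simp
  ring

lemma Q_le_exp_neg_abs {p : ℕ} (hp : 2 ≤ p) (x : ℝ) :
    Q p x ≤ (2 * ((p : ℝ) + 1)) ^ (1 / ((p : ℝ) - 1)) * exp (-|x|) := by
  have hp' : (2 : ℝ) ≤ p := by exact_mod_cast hp
  have hp1 : 0 < (p : ℝ) - 1 := by linarith
  have hexp : exp (-|x|) = exp (-(((p : ℝ) - 1) * |x|)) ^ (1 / ((p : ℝ) - 1)) := by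
    rw [← exp_mul]
    congr 1
    field_simp
  rw [hexp, ← mul_rpow (by positivity) (by positivity)]
  unfold Q
  have hc := cosh_pos ((((p : ℝ) - 1) / 2) * x)
  refine rpow_le_rpow (by positivity) ?_ (by positivity)
  have hcosh : exp ((((p : ℝ) - 1) / 2) * |x|) / 2 ≤ cosh ((((p : ℝ) - 1) / 2) * x) := by
    rw [← cosh_abs, abs_mul, abs_of_pos (half_pos hp1), cosh_eq]
    have := exp_pos (-((((p : ℝ) - 1) / 2) * |x|))
    linarith
  have hsq : exp (((p : ℝ) - 1) * |x|) = exp ((((p : ℝ) - 1) / 2) * |x|) ^ 2 := by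
    rw [← exp_nat_mul]
    congr 1
    push_cast
    ring
  rw [exp_neg, hsq, ← div_eq_mul_inv, div_le_div_iff₀ (by positivity) (by positivity)]
  have := pow_le_pow_left₀ (by positivity) hcosh 2
  nlinarith

lemma continuous_Q {p : ℕ} (hp : 2 ≤ p) : Continuous (Q p) :=
  continuous_iff_continuousAt.2 fun x => (hasDerivAt_Q hp x).continuousAt

lemma integrable_Q_sq {p : ℕ} (hp : 2 ≤ p) : Integrable fun x => Q p x ^ 2 := by
  refine (integrable_inv_one_add_sq.const_mul
    (((2 * ((p : ℝ) + 1)) ^ (1 / ((p : ℝ) - 1))) ^ 2)).mono'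
    ((continuous_Q hp).pow 2).aestronglyMeasurable (.of_forall fun x => ?_)
  rw [norm_of_nonneg (by positivity)]
  refine (pow_le_pow_left₀ (Q_pos p x).le (Q_le_exp_neg_abs hp x) 2).trans ?_
  rw [mul_pow, exp_neg, inv_pow]
  gcongr
  have h := pow_le_pow_left₀ (by positivity) (add_one_le_exp |x|) 2
  nlinarith [abs_nonneg x, sq_abs x]

/-- Pohozaev-type identity: `2 ∫ Q'² = ((p−1)/(p+1)) ∫ Q^(p+1)`. -/
theorem stmt4 (p : ℕ) (hp : 2 ≤ p) :
    2 * ∫ x : ℝ, deriv (Q p) x ^ 2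
      = (((p : ℝ) - 1) / ((p : ℝ) + 1)) * ∫ x : ℝ, Q p x ^ (p + 1) := by
  set k : ℝ := ((p : ℝ) - 1) / 2 with hk
  have hderiv : ∀ x, deriv (Q p) x = -(tanh (k * x) * Q p x) := fun x => (hasDerivAt_Q hp x).deriv
  have htanh : ∀ x, HasDerivAt (fun y => tanh (k * y)) (k * (1 / cosh (k * x) ^ 2)) x := by
    intro x
    have hc := cosh_pos (k * x)
    have hlin : HasDerivAt (fun y => k * y) k x := by
      simpa using (hasDerivAt_id x).const_mul k
    simp only [tanh_eq_sinh_div_cosh]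
    refine (hlin.sinh.div hlin.cosh hc.ne').congr_deriv ?_
    field_simp
    linear_combination k * cosh_sq (k * x)
  have htc : Continuous fun y => tanh (k * y) :=
    continuous_iff_continuousAt.2 fun x => (htanh x).continuousAt
  have hsq := integrable_Q_sq hp
  have hint1 : Integrable fun x => tanh (k * x) * Q p x ^ 2 :=
    hsq.bdd_mul (c := 1) htc.aestronglyMeasurable (.of_forall fun x => (abs_tanh_lt_one _).le)
  have hint2 : Integrable fun x => deriv (Q p) x ^ 2 := by
    refine (hint1.bdd_mul (c := 1) htc.aestronglyMeasurable
      (.of_forall fun x => (abs_tanh_lt_one _).le)).congr (.of_forall fun x => ?_)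
    simp only [hderiv]
    ring
  have hint3 : Integrable fun x => Q p x ^ (p + 1) := by
    refine (hsq.sub hint2).const_mul (((p : ℝ) + 1) / 2) |>.congr (.of_forall fun x => ?_)
    have hc := cosh_pos (k * x)
    simp only [hderiv, Q_pow_succ hp, Pi.sub_apply, ← hk, tanh_eq_sinh_div_cosh]
    field_simp
    linear_combination Q p x ^ 2 * cosh_sq (k * x)
  have hF : ∀ x, HasDerivAt (fun x => tanh (k * x) * Q p x ^ 2)
      (((p : ℝ) - 1) / ((p : ℝ) + 1) * Q p x ^ (p + 1) - 2 * deriv (Q p) x ^ 2) x := by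
    intro x
    have hc := cosh_pos (k * x)
    refine ((htanh x).mul ((hasDerivAt_Q hp x).pow 2)).congr_deriv ?_
    simp only [hderiv, Q_pow_succ hp, Pi.pow_apply, ← hk]
    have : (p : ℝ) - 1 = 2 * k := by rw [hk]; ring
    rw [this]
    field_simp
    ring
  have h0 := integral_eq_zero_of_hasDerivAt_of_integrable hF
    ((hint3.const_mul _).sub (hint2.const_mul 2)) hint1
  rw [integral_sub (hint3.const_mul _) (hint2.const_mul 2), integral_const_mul,
    integral_const_mul] at h0
  linarith
end

section
/- The function Q^((p+1)/2) is an eigenfunction of the linearized operator L with eigenvalue −λ₀ where λ₀ = (1/4)(p−1)(p+3) > 0; that is, for every x ∈ ℝ one has −(Q^((p+1)/2))''(x) + Q(x)^((p+1)/2) − p·Q(x)^(p−1)·Q(x)^((p+1)/2) = −((p−1)(p+3)/4)·Q(x)^((p+1)/2). -/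
theorem hasDerivAt_cosh_mul_rpow (a r x : ℝ) :
    HasDerivAt (fun y : ℝ => Real.cosh (a * y) ^ r)
      (r * a * Real.sinh (a * x) * Real.cosh (a * x) ^ (r - 1)) x := by
  have h1 : HasDerivAt (fun y : ℝ => a * y) a x := by
    simpa using (hasDerivAt_id x).const_mul a
  convert h1.cosh.rpow_const (p := r) (Or.inl (Real.cosh_pos _).ne') using 1
  ring

theorem deriv_deriv_cosh_mul_rpow (a r x : ℝ) :
    deriv (deriv (fun y : ℝ => Real.cosh (a * y) ^ r)) x =
      (r * a) ^ 2 * Real.cosh (a * x) ^ r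
        - r * (r - 1) * a ^ 2 * Real.cosh (a * x) ^ (r - 2) := by
  have hd : deriv (fun y : ℝ => Real.cosh (a * y) ^ r) =
      fun y => r * a * Real.sinh (a * y) * Real.cosh (a * y) ^ (r - 1) :=
    funext fun y => (hasDerivAt_cosh_mul_rpow a r y).deriv
  have h1 : HasDerivAt (fun y : ℝ => a * y) a x := by
    simpa using (hasDerivAt_id x).const_mul a
  have hc : 0 < Real.cosh (a * x) := Real.cosh_pos _
  rw [hd, ((h1.sinh.const_mul (r * a)).fun_mul (hasDerivAt_cosh_mul_rpow a (r - 1) x)).deriv]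
  have e1 : Real.cosh (a * x) ^ (r - 1) = Real.cosh (a * x) ^ (r - 2) * Real.cosh (a * x) := by
    rw [← Real.rpow_add_one hc.ne']; ring_nf
  have e2 : Real.cosh (a * x) ^ r = Real.cosh (a * x) ^ (r - 2) * Real.cosh (a * x) ^ 2 := by
    rw [← Real.rpow_natCast, ← Real.rpow_add hc]; norm_num
  rw [show r - 1 - 1 = r - 2 by ring, e1, e2]
  linear_combination (-(r * (r - 1) * a ^ 2 * Real.cosh (a * x) ^ (r - 2))) *
    Real.cosh_sq_sub_sinh_sq (a * x)

theorem Q_rpow (p : ℕ) (s x : ℝ) :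
    Q p x ^ s = (((p : ℝ) + 1) / 2) ^ (s / ((p : ℝ) - 1)) *
      Real.cosh ((((p : ℝ) - 1) / 2) * x) ^ (-(2 * s / ((p : ℝ) - 1))) := by
  have hc : 0 < Real.cosh ((((p : ℝ) - 1) / 2) * x) := Real.cosh_pos _
  rw [Q, ← Real.rpow_mul (by positivity), ← div_div, Real.div_rpow (by positivity) (by positivity),
    Real.rpow_neg hc.le, ← Real.rpow_natCast, ← Real.rpow_mul hc.le, div_eq_mul_inv]
  push_cast
  ring_nf

theorem Q_pow_sub_one (p : ℕ) (hp : 2 ≤ p) (x : ℝ) :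
    Q p x ^ (p - 1) =
      ((p : ℝ) + 1) / 2 * Real.cosh ((((p : ℝ) - 1) / 2) * x) ^ (-2 : ℝ) := by
  have hp' : (p : ℝ) - 1 ≠ 0 := by
    have : (2 : ℝ) ≤ p := by exact_mod_cast hp
    linarith
  rw [← Real.rpow_natCast, Q_rpow, Nat.cast_sub (by omega), Nat.cast_one, div_self hp',
    mul_div_assoc, div_self hp', Real.rpow_one, mul_one]

/-- `Q^((p+1)/2)` is an eigenfunction of `L = −∂² + 1 − pQ^(p−1)` with eigenvalue
`−(p−1)(p+3)/4`. -/
theorem stmt6 (p : ℕ) (hp : 2 ≤ p) (x : ℝ) :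
    -(deriv (deriv (fun y : ℝ => Q p y ^ (((p : ℝ) + 1) / 2))) x)
      + Q p x ^ (((p : ℝ) + 1) / 2)
      - (p : ℝ) * Q p x ^ (p - 1) * Q p x ^ (((p : ℝ) + 1) / 2)
      = -((((p : ℝ) - 1) * ((p : ℝ) + 3)) / 4) * Q p x ^ (((p : ℝ) + 1) / 2) := by
  have hp' : (p : ℝ) - 1 ≠ 0 := by
    have : (2 : ℝ) ≤ p := by exact_mod_cast hp
    linarith
  have hc : 0 < Real.cosh ((((p : ℝ) - 1) / 2) * x) := Real.cosh_pos _
  simp only [Q_rpow, Q_pow_sub_one p hp, deriv_const_mul_field']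
  rw [deriv_deriv_cosh_mul_rpow, sub_eq_add_neg _ (2 : ℝ), Real.rpow_add hc]
  generalize Real.cosh ((((p : ℝ) - 1) / 2) * x) ^ (-2 : ℝ) = u
  generalize Real.cosh ((((p : ℝ) - 1) / 2) * x) ^ (_ : ℝ) = v
  generalize (((p : ℝ) + 1) / 2) ^ (_ : ℝ) = w
  field_simp
  ring
end

section
/- Let μ > 0 and a ≥ 2μ, and define v : ℝ → ℝ by v(x) = e^(−a·x)·∫_{−∞}^{x} e^(a·s)·e^(−μ·|s|) ds. Then for every x ∈ ℝ one has v(x) ≤ (2/μ)·e^(−μ·|x|). -/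
/-- If `μ > 0`, `a ≥ 2μ` and `v(x) = e^(−ax) ∫_{−∞}^x e^(as) e^(−μ|s|) ds`, then
`v(x) ≤ (2/μ) e^(−μ|x|)` for every `x`. -/
theorem stmt17 (μ a : ℝ) (hμ : 0 < μ) (ha : 2 * μ ≤ a) (x : ℝ) :
    Real.exp (-(a * x)) * (∫ s in Set.Iio x, Real.exp (a * s) * Real.exp (-(μ * |s|)))
      ≤ (2 / μ) * Real.exp (-(μ * |x|)) := by
  have hb : 0 < a - μ := by linarith
  have hint : ∫ s in Set.Iio x, Real.exp (a * s) * Real.exp (-(μ * |s|)) ≤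
      ∫ s in Set.Iio x, Real.exp (μ * x - μ * |x|) * Real.exp ((a - μ) * s) := by
    refine MeasureTheory.integral_mono_of_nonneg (.of_forall fun s => by positivity)
      (((integrableOn_exp_mul_Iic hb x).mono_set Set.Iio_subset_Iic_self).const_mul _) ?_
    refine (MeasureTheory.ae_restrict_iff' measurableSet_Iio).2 (.of_forall fun s hs => ?_)
    have hsx : s < x := hs
    have habs : |x| ≤ |s| + (x - s) := by
      have := abs_add_le s (x - s)
      rwa [add_sub_cancel, abs_of_pos (sub_pos.2 hsx)] at this
    simp only [← Real.exp_add]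
    apply Real.exp_le_exp.2
    nlinarith [mul_le_mul_of_nonneg_left habs hμ.le]
  rw [MeasureTheory.integral_const_mul, ← MeasureTheory.integral_Iic_eq_integral_Iio,
    ← MeasureTheory.integral_Iic_eq_integral_Iio, integral_exp_mul_Iic hb] at hint
  rw [← MeasureTheory.integral_Iic_eq_integral_Iio]
  calc _ ≤ Real.exp (-(a * x)) *
        (Real.exp (μ * x - μ * |x|) * (Real.exp ((a - μ) * x) / (a - μ))) := by gcongr
    _ = 1 / (a - μ) * Real.exp (-(μ * |x|)) := by
      rw [show -(μ * |x|) = -(a * x) + ((μ * x - μ * |x|) + (a - μ) * x) by ring,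
        Real.exp_add, Real.exp_add]
      ring
    _ ≤ 2 / μ * Real.exp (-(μ * |x|)) := by
      gcongr
      · norm_num
      · linarith
end
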